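/- arXiv:2205.15352 — 2 statements merged into one kernel-verified Lean document; each statement's English description precedes it below -/
import Mathlib

section
/- For every integer r ≥ 2 there exists a constant N(r) ∈ ℕ such that for every prime p > N(r), every field K of characteristic zero, and every finite subgroup G ≤ GL_r(K), there is no surjective group homomorphism from G onto GL_r(𝔽_p). -/
open Module

theorem joint {K V G ι : Type*} [Field K] [IsAlgClosed K] [CharZero K] [AddCommGroup V] [Module K V]
    [FiniteDimensional K V] [Group G] [Finite G] (ρ : G →* Module.End K V) (g : ι → G)
    (hg : ∀ i j, Commute (g i) (g j)) :
    ⨆ χ : ι → K, ⨅ i, (ρ (g i)).eigenspace (χ i) = ⊤ := by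
  have h1 : ∀ i, (ρ (g i)).IsSemisimple := by
    intro i
    refine Module.End.isSemisimple_of_squarefree_aeval_eq_zero
      (p := Polynomial.X ^ (Nat.card G) - 1) ?_ ?_
    · apply Polynomial.Separable.squarefree
      rw [Polynomial.X_pow_sub_one_separable_iff]
      exact_mod_cast Nat.card_pos.ne'
    · rw [map_sub, map_pow, Polynomial.aeval_X, ← map_pow, pow_card_eq_one', map_one, map_one, sub_self]
  have h2 := Module.End.iSup_iInf_maxGenEigenspace_eq_top_of_iSup_maxGenEigenspace_eq_top_of_commute
    (fun i => ρ (g i)) (fun i j _ => (hg i j).map ρ) (fun i => Module.End.iSup_maxGenEigenspace_eq_top _)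
  rw [← h2]
  refine iSup_congr fun χ => iInf_congr fun i => ?_
  exact ((h1 i).isFinitelySemisimple.maxGenEigenspace_eq_eigenspace _).symm

/-- linear maps agreeing on joint eigenvectors agree -/
theorem joint_ext {K V G ι : Type*} [Field K] [IsAlgClosed K] [CharZero K] [AddCommGroup V] [Module K V]
    [FiniteDimensional K V] [Group G] [Finite G] (ρ : G →* Module.End K V) (g : ι → G)
    (hg : ∀ i j, Commute (g i) (g j)) :
    Submodule.span K {v : V | v ≠ 0 ∧ ∃ χ : ι → K, ∀ i, ρ (g i) v = χ i • v} = ⊤ := by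
  rw [eq_top_iff, ← joint ρ g hg]
  refine iSup_le fun χ v hv => ?_
  by_cases h0 : v = 0
  · rw [h0]; exact Submodule.zero_mem _
  · refine Submodule.subset_span ⟨h0, χ, fun i => ?_⟩
    simp only [Submodule.mem_iInf] at hv
    exact Module.End.mem_eigenspace_iff.1 (hv i)

theorem comm_one {K V G : Type*} [Field K] [IsAlgClosed K] [CharZero K] [AddCommGroup V] [Module K V]
    [FiniteDimensional K V] [Group G] [Finite G] (ρ : G →* Module.End K V) (p k : ℕ) (hp : p.Prime)
    (hV : finrank K V < p) (x g z : G) (h : x * g = z * g * x) (hzx : Commute z x)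
    (hzg : Commute z g) (hz : z ^ p ^ k = 1) : ρ z = 1 := by
  have hs := joint_ext ρ (fun b : Bool => if b then z else x) (by
    rintro (_|_) (_|_) <;> simp [hzx, hzx.symm])
  refine LinearMap.ext_on hs ?_
  rintro v ⟨hv, χ, hχ⟩
  have hzv := hχ true
  have hxv := hχ false
  simp only [if_true, Bool.false_eq_true, if_false] at hzv hxv
  generalize χ true = ζ at hzv
  generalize χ false = μ at hxv
  suffices ζ = 1 by simp [hzv, this]
  by_contra hζ
  have inj : ∀ a : G, Function.Injective (ρ a) := fun a => by
    refine Function.LeftInverse.injective (g := ρ a⁻¹) fun w => ?_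
    rw [← Module.End.mul_apply, ← map_mul]; simp
  have hμ : μ ≠ 0 := by
    rintro rfl
    rw [zero_smul] at hxv
    exact hv (inj x (by simpa using hxv))
  have hzn : ∀ n : ℕ, ρ (z ^ n) v = ζ ^ n • v := by
    intro n
    induction n with
    | zero => simp
    | succ n ih => rw [pow_succ, map_mul, Module.End.mul_apply, hzv, map_smul, ih, smul_smul, pow_succ']
  have hζp : ζ ^ p ^ k = 1 := by
    have := hzn (p ^ k)
    rw [hz, map_one, Module.End.one_apply] at this
    have h3 : (ζ ^ p ^ k - 1) • v = 0 := by rw [sub_smul, one_smul, ← this, sub_self]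
    exact sub_eq_zero.1 ((smul_eq_zero.1 h3).resolve_right hv)
  have hord : p ≤ orderOf ζ := by
    obtain ⟨j, hj, hjo⟩ := (Nat.dvd_prime_pow hp).1 (orderOf_dvd_of_pow_eq_one hζp)
    rw [hjo]
    refine Nat.le_self_pow ?_ _
    rintro rfl
    exact hζ (orderOf_eq_one_iff.1 (by simpa using hjo))
  have hrel : ∀ n : ℕ, x * g ^ n = g ^ n * x * z ^ n := by
    intro n
    induction n with
    | zero => simp
    | succ n ih =>
      have e1 : x * g = g * x * z := by rw [h, mul_assoc]; exact (hzg.mul_right hzx).eq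
      have e2 : z ^ n * g = g * z ^ n := (hzg.pow_left n).eq
      rw [pow_succ, ← mul_assoc, ih, mul_assoc (g ^ n * x), e2, ← mul_assoc, mul_assoc (g^n), e1,
        pow_succ' z]
      simp only [mul_assoc]
  have hli := Module.End.eigenvectors_linearIndependent' (ρ x) (fun n : Fin p => ζ ^ (n : ℕ) * μ)
    (by
      intro a b hab
      have := mul_right_cancel₀ hμ hab
      exact Fin.ext (pow_injOn_Iio_orderOf (by simp; omega) (by simp; omega) this))
    (fun n => ρ (g ^ (n : ℕ)) v) (by
      intro n
      refine ⟨Module.End.mem_eigenspace_iff.2 ?_, ?_⟩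
      · rw [← Module.End.mul_apply, ← map_mul, hrel, map_mul, Module.End.mul_apply, hzn, map_smul,
          map_mul, Module.End.mul_apply, hxv, map_smul, smul_smul]
      · intro h0
        exact hv (inj _ (by rw [h0, map_zero])))
  have := hli.fintype_card_le_finrank
  simp at this
  omega

theorem pgroup_comm {K V P : Type*} [Field K] [IsAlgClosed K] [CharZero K] [AddCommGroup V] [Module K V]
    [FiniteDimensional K V] [Group P] [Finite P] (ρ : P →* Module.End K V)
    (hρ : Function.Injective ρ) (p : ℕ) [hp : Fact p.Prime]
    (hV : finrank K V < p) (hP : IsPGroup p P) (a b : P) : Commute a b := by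
  suffices h : Subgroup.center P = ⊤ by
    have : a ∈ Subgroup.center P := h ▸ Subgroup.mem_top a
    exact (Subgroup.mem_center_iff.1 this b).symm
  by_contra hc
  have hnt : Nontrivial (P ⧸ Subgroup.center P) := QuotientGroup.nontrivial_iff.2 hc
  have := (hP.to_quotient (Subgroup.center P)).center_nontrivial
  obtain ⟨⟨y, hy⟩, hy1⟩ := exists_ne (1 : Subgroup.center (P ⧸ Subgroup.center P))
  obtain ⟨x, rfl⟩ := QuotientGroup.mk_surjective y
  apply hy1
  ext
  simp only [Subgroup.coe_one]
  rw [QuotientGroup.eq_one_iff, Subgroup.mem_center_iff]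
  intro g
  have hz : x * g * x⁻¹ * g⁻¹ ∈ Subgroup.center P := by
    rw [← QuotientGroup.eq_one_iff]
    have := Subgroup.mem_center_iff.1 hy g
    rw [QuotientGroup.mk_mul, QuotientGroup.mk_mul, QuotientGroup.mk_mul, ← this]
    rw [QuotientGroup.mk_inv, QuotientGroup.mk_inv]; group
  obtain ⟨k, hk⟩ := hP (x * g * x⁻¹ * g⁻¹)
  have hz' := Subgroup.mem_center_iff.1 hz
  have h1 := comm_one ρ p k hp.out hV x g (x * g * x⁻¹ * g⁻¹) (by group) (hz' x).symm (hz' g).symm hk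
  have h2 := hρ (h1.trans (map_one ρ).symm)
  have : x * g = g * x := by
    have := congrArg (· * (g * x)) h2
    simpa [mul_assoc] using this
  exact this.symm

theorem count {K V G ι : Type*} [Field K] [IsAlgClosed K] [CharZero K] [AddCommGroup V] [Module K V]
    [FiniteDimensional K V] [Group G] [Finite G] (ρ : G →* Module.End K V)
    (hρ : Function.Injective ρ) [Fintype ι] (g : ι → G) (hinj : Function.Injective g)
    (hg : ∀ i j, Commute (g i) (g j)) (x : G) (hx : ∀ i, ∃ n : G, n * x * n⁻¹ = g i) :
    Fintype.card ι ≤ finrank K V ^ finrank K V := by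
  classical
  have hs := (joint_ext ρ g hg).ge
  let b := Basis.ofSpan hs
  have hb : ∀ j, b j ≠ 0 ∧ ∃ χ : ι → K, ∀ i, ρ (g i) (b j) = χ i • b j := fun j =>
    Basis.ofSpan_subset hs ⟨j, rfl⟩
  choose hb0 χ hχ using hb
  let S := (ρ x).charpoly.roots.toFinset
  have hS : S.card ≤ finrank K V := by
    rw [← (ρ x).charpoly_natDegree]
    exact (Multiset.toFinset_card_le _).trans (Polynomial.card_roots' _)
  have hmem : ∀ i j, χ j i ∈ S := by
    intro i j
    obtain ⟨n, hn⟩ := hx i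
    simp only [S, Multiset.mem_toFinset]
    rw [Polynomial.mem_roots (LinearMap.charpoly_monic _).ne_zero,
      ← Module.End.hasEigenvalue_iff_isRoot_charpoly]
    apply Module.End.hasEigenvalue_of_hasEigenvector (x := ρ n⁻¹ (b j))
    refine ⟨Module.End.mem_eigenspace_iff.2 ?_, ?_⟩
    · have : x * n⁻¹ = n⁻¹ * g i := by rw [← hn]; group
      rw [← Module.End.mul_apply, ← map_mul, this, map_mul, Module.End.mul_apply, hχ, map_smul]
    · intro h0
      apply hb0 j
      have := congrArg (ρ n) h0
      rw [← Module.End.mul_apply, ← map_mul] at this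
      simpa using this
  have key : Function.Injective (fun i : ι => fun j => (⟨χ j i, hmem i j⟩ : S)) := by
    intro i i' h
    apply hinj
    apply hρ
    refine b.ext fun j => ?_
    rw [hχ, hχ]
    have := congrArg Subtype.val (congrFun h j)
    simp only at this
    rw [this]
  have hfb := Module.Finite.finite_basis b
  have h1 := Nat.card_le_card_of_injective _ key
  rw [Nat.card_fun, Nat.card_eq_fintype_card, ← finrank_eq_nat_card_basis b,
    Nat.card_eq_fintype_card, Fintype.card_coe] at h1
  exact h1.trans (Nat.pow_le_pow_left hS _)

theorem core {G Q : Type*} [Group G] [Finite G] [Group Q] (p : ℕ) [hp : Fact p.Prime] (f : G →* Q)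
    (u : Q) (hu : orderOf u = p) (hN : ((Subgroup.zpowers u).comap f).Normal) (hmem : u ∈ f.range) :
    ∃ P : Subgroup G, IsPGroup p P ∧ (∃ x ∈ P, f x = u) ∧
      ∀ g, ∃ n : G, (∀ y ∈ P, n * y * n⁻¹ ∈ P) ∧ f n * u * (f n)⁻¹ = f g * u * (f g)⁻¹ := by
  let M := (Subgroup.zpowers u).comap f
  obtain ⟨S⟩ : Nonempty (Sylow p M) := inferInstance
  have hsurj : Function.Surjective (f.subgroupComap (Subgroup.zpowers u)) := by
    rintro ⟨y, hy⟩
    obtain ⟨k, rfl⟩ := Subgroup.mem_zpowers_iff.1 hy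
    obtain ⟨x, hx⟩ := hmem
    refine ⟨⟨x ^ k, ?_⟩, ?_⟩
    · simp [Subgroup.mem_comap, hx]
    · apply Subtype.ext
      change f (x ^ k) = u ^ k
      rw [map_zpow, hx]
  have hpg : IsPGroup p (Subgroup.zpowers u) := IsPGroup.of_card (n := 1) (by simp [hu])
  refine ⟨(S : Subgroup M).map M.subtype, S.isPGroup'.map _, ?_, ?_⟩
  · have htop : ((S.mapSurjective hsurj : Sylow p _) : Subgroup (Subgroup.zpowers u)) = ⊤ :=
      ((S.mapSurjective hsurj).is_maximal' (Q := ⊤) (hpg.to_subgroup _) le_top).symm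
    have : (⟨u, Subgroup.mem_zpowers u⟩ : Subgroup.zpowers u) ∈
        ((S.mapSurjective hsurj : Sylow p _) : Subgroup (Subgroup.zpowers u)) := by
      rw [htop]; trivial
    rw [Sylow.coe_mapSurjective] at this
    obtain ⟨x, hx, hxu⟩ := this
    exact ⟨x, ⟨x, hx, rfl⟩, congrArg Subtype.val hxu⟩
  · intro g
    have hs := Sylow.normalizer_sup_eq_top S
    have hg : g ∈ Subgroup.normalizer ((S : Subgroup M).map M.subtype : Set G) ⊔ M := by
      rw [hs]; trivial
    obtain ⟨n, hn, z, hz, rfl⟩ := Subgroup.mem_sup_of_normal_right.1 hg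
    refine ⟨n, fun y hy => (Subgroup.mem_normalizer_iff.1 hn y).1 hy, ?_⟩
    obtain ⟨k, hk⟩ := Subgroup.mem_zpowers_iff.1 (Subgroup.mem_comap.1 hz)
    rw [map_mul, ← hk]
    group

theorem matrices (p r : ℕ) [hp : Fact p.Prime] (hr : 2 ≤ r) :
    ∃ u : GL (Fin r) (ZMod p), orderOf u = p ∧
      ∀ a : (ZMod p)ˣ, ∃ d : GL (Fin r) (ZMod p), d * u * d⁻¹ = u ^ (a : ZMod p).val := by
  let i : Fin r := ⟨0, by omega⟩
  let j : Fin r := ⟨1, by omega⟩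
  have hij : i ≠ j := by simp [i, j]
  let u : GL (Fin r) (ZMod p) := Matrix.GeneralLinearGroup.mkOfDetNeZero
    (Matrix.transvection i j 1) (by rw [Matrix.det_transvection_of_ne _ _ hij]; exact one_ne_zero)
  have hpow : ∀ n : ℕ, ((u ^ n : GL (Fin r) (ZMod p)) : Matrix (Fin r) (Fin r) (ZMod p)) =
      Matrix.transvection i j (n : ZMod p) := by
    intro n
    induction n with
    | zero => simp
    | succ n ih =>
      rw [pow_succ, Units.val_mul, ih]
      change _ * Matrix.transvection i j 1 = _
      rw [Matrix.transvection_mul_transvection_same _ _ hij]; push_cast; rfl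
  refine ⟨u, orderOf_eq_prime ?_ ?_, fun a => ?_⟩
  · ext1
    rw [hpow]; simp
  · intro h
    have h1 := congrArg (fun v : GL (Fin r) (ZMod p) => (v : Matrix (Fin r) (Fin r) (ZMod p)) i j) h
    change Matrix.transvection i j 1 i j = (1 : Matrix (Fin r) (Fin r) (ZMod p)) i j at h1
    simp [Matrix.transvection, hij] at h1
  · let d : GL (Fin r) (ZMod p) := Matrix.GeneralLinearGroup.mkOfDetNeZero
      (Matrix.diagonal (Function.update 1 i (a : ZMod p))) (by
        rw [Matrix.det_diagonal, Finset.prod_ne_zero_iff]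
        intro k _
        by_cases hk : k = i
        · subst hk; simp
        · simp [hk])
    refine ⟨d, ?_⟩
    rw [mul_inv_eq_iff_eq_mul]
    ext1
    rw [Units.val_mul, Units.val_mul, hpow, ZMod.natCast_zmod_val]
    change Matrix.diagonal _ * Matrix.transvection i j 1 = _ * Matrix.diagonal _
    ext k l
    rw [Matrix.diagonal_mul, Matrix.mul_diagonal]
    simp only [Matrix.transvection, Matrix.add_apply, Matrix.one_apply, Matrix.single_apply,
      Function.update_apply, Pi.one_apply]
    clear hpow
    clear_value d u i j
    by_cases h1 : i = k
    · subst h1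
      by_cases h2 : j = l
      · subst h2
        simp [hij, hij.symm]
      · by_cases h3 : i = l
        · subst h3; simp [hij.symm]
        · simp [h2, h3]
    · have h1' : ¬ k = i := fun h => h1 h.symm
      by_cases h2 : k = l
      · subst h2; simp [h1, h1']
      · simp [h1, h1', h2]

theorem bound {K V G : Type*} [Field K] [IsAlgClosed K] [CharZero K] [AddCommGroup V] [Module K V]
    [FiniteDimensional K V] [Group G] [Finite G] (ρ : G →* Module.End K V)
    (hρ : Function.Injective ρ) (p r : ℕ) [hp : Fact p.Prime] (hr : 2 ≤ r) (hV : finrank K V = r)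
    (hrp : r < p) (f : G →* GL (Fin r) (ZMod p)) (hf : Function.Surjective f) :
    p - 1 ≤ r ^ r := by
  obtain ⟨u, hu, hd⟩ := matrices p r hr
  let T := Subgroup.normalizer (Subgroup.zpowers u : Set (GL (Fin r) (ZMod p)))
  let D := T.comap f
  have huT : u ∈ T := Subgroup.le_normalizer (Subgroup.mem_zpowers u)
  obtain ⟨P, hP, ⟨x, hxP, hxu⟩, hn⟩ := core p (f.comp D.subtype) u hu (by
    constructor
    rintro n hn ⟨g, hg⟩
    exact (Subgroup.mem_normalizer_iff.1 hg _).1 hn |> fun h => by simpa using h) (by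
    obtain ⟨y, hy⟩ := hf u
    exact ⟨⟨y, by simpa [D, hy] using huT⟩, hy⟩)
  have hconj : ∀ a : (ZMod p)ˣ, ∃ n : D, n * x * n⁻¹ ∈ P ∧
      f (n * x * n⁻¹ : D) = u ^ (a : ZMod p).val := by
    intro a
    obtain ⟨d, hda⟩ := hd a
    obtain ⟨g, rfl⟩ := hf d
    have hgD : g ∈ D := by
      refine Subgroup.mem_comap.2 ?_
      have hfin : Finite (Subgroup.zpowers u) := inferInstance
      have hle : ∀ h ∈ Subgroup.zpowers u, f g * h * (f g)⁻¹ ∈ Subgroup.zpowers u := by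
        intro h hh
        obtain ⟨k, rfl⟩ := Subgroup.mem_zpowers_iff.1 hh
        rw [← conj_zpow, hda]
        exact Subgroup.zpow_mem _ (Subgroup.npow_mem_zpowers _ _) _
      exact Subgroup.mem_normalizer_fintype hle
    obtain ⟨n, hn1, hn2⟩ := hn ⟨g, hgD⟩
    refine ⟨n, hn1 x hxP, ?_⟩
    have e : f (n * x * n⁻¹ : D) = f n * f x * (f n)⁻¹ := by simp
    simp only [MonoidHom.comp_apply, Subgroup.subtype_apply] at hxu hn2
    rw [e, hxu, hn2, hda]
  choose n hnP hnf using hconj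
  have hcomm : ∀ y ∈ P, ∀ z ∈ P, Commute y z := by
    intro y hy z hz
    have := pgroup_comm (ρ.comp (D.subtype.comp P.subtype))
      (hρ.comp (Subtype.val_injective.comp Subtype.val_injective)) p (hV ▸ hrp) hP ⟨y, hy⟩ ⟨z, hz⟩
    exact congrArg Subtype.val this.eq
  have := count (ρ.comp D.subtype) (hρ.comp Subtype.val_injective)
    (fun a : (ZMod p)ˣ => n a * x * (n a)⁻¹) (by
      intro a b hab
      have h1 : u ^ (a : ZMod p).val = u ^ (b : ZMod p).val := by
        rw [← hnf, ← hnf]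
        exact congrArg (fun y : D => f y) hab
      have h2 := pow_injOn_Iio_orderOf (by simp [hu, ZMod.val_lt]) (by simp [hu, ZMod.val_lt]) h1
      exact Units.ext (ZMod.val_injective p h2))
    (fun a b => hcomm _ (hnP a) _ (hnP b)) x (fun a => ⟨n a, rfl⟩)
  rwa [ZMod.card_units, hV] at this

/-- For every `r ≥ 2` there is a constant `N(r)` such that for every prime `p > N(r)`,
every field `K` of characteristic zero, and every finite subgroup `G ≤ GL_r(K)`, there
is no surjective group homomorphism `G ↠ GL_r(𝔽_p)`. -/
theorem no_finite_char_zero_subgroup_surjects_onto_GL_mod_p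
    (r : ℕ) (hr : 2 ≤ r) :
    ∃ Nr : ℕ, ∀ p : ℕ, p.Prime → Nr < p →
      ∀ (K : Type*) [Field K] [CharZero K]
        (G : Subgroup (GL (Fin r) K)), Finite ↥G →
        ¬ ∃ f : ↥G →* GL (Fin r) (ZMod p), Function.Surjective f := by
  refine ⟨r ^ r + 1, ?_⟩
  rintro p hp hlt K _ _ G hG ⟨f, hf⟩
  have : Fact p.Prime := ⟨hp⟩
  have hrr : r ≤ r ^ r := Nat.le_self_pow (by omega) r
  let ρ : G →* Module.End (AlgebraicClosure K) (Fin r → AlgebraicClosure K) :=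
    ((Matrix.toLinAlgEquiv' (R := AlgebraicClosure K) (n := Fin r) :
      Matrix (Fin r) (Fin r) (AlgebraicClosure K) →* Module.End (AlgebraicClosure K) (Fin r → AlgebraicClosure K)).comp
      (Units.coeHom _)).comp
      ((Matrix.GeneralLinearGroup.map (algebraMap K (AlgebraicClosure K))).comp G.subtype)
  have hρ : Function.Injective ρ := by
    intro a b hab
    have h1 := Matrix.toLinAlgEquiv'.injective hab
    have h2 := Units.val_injective h1
    apply Subtype.ext
    ext i j
    have h3 := congrArg (fun v : GL (Fin r) (AlgebraicClosure K) =>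
      (v : Matrix (Fin r) (Fin r) (AlgebraicClosure K)) i j) h2
    exact (algebraMap K (AlgebraicClosure K)).injective h3
  have := bound ρ hρ p r hr (by simp) (by omega) f hf
  omega
end

section
/- Let F₂ be the free group on two generators x, y, and let ρ : F₂ → GL₃(ℂ) be the representation determined by ρ(x) = [[1,0,1],[0,1,0],[0,0,1]] and ρ(y) = [[1,0,0],[0,1,1],[0,0,1]]. Then ρ has infinite image, and the conjugacy class of ρ is fixed by the action of Out(F₂): for every automorphism φ of F₂ there exists B ∈ GL₃(ℂ) with ρ(φ(w)) = B ρ(w) B⁻¹ for all w ∈ F₂. In particular, there is a representation of F₂ of rank 3 = 2+1 with infinite image whose conjugacy class has finite orbit under Out(F₂). -/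
/-- The given pair of unipotent matrices satisfies `ρ(x) = [[1,0,1],[0,1,0],[0,0,1]]`,
`ρ(y) = [[1,0,0],[0,1,1],[0,0,1]]`. -/
def HasGivenValues (ρ : FreeGroup (Fin 2) →* GL (Fin 3) ℂ) : Prop :=
  ((ρ (FreeGroup.of 0) : GL (Fin 3) ℂ) : Matrix (Fin 3) (Fin 3) ℂ)
      = !![1, 0, 1; 0, 1, 0; 0, 0, 1] ∧
  ((ρ (FreeGroup.of 1) : GL (Fin 3) ℂ) : Matrix (Fin 3) (Fin 3) ℂ)
      = !![1, 0, 0; 0, 1, 1; 0, 0, 1]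

/-- The translation matrix. -/
def umat (a b : ℂ) : Matrix (Fin 3) (Fin 3) ℂ := !![1, 0, a; 0, 1, b; 0, 0, 1]

lemma umat_mul (a b c d : ℂ) : umat a b * umat c d = umat (a + c) (b + d) := by
  ext i j
  fin_cases i <;> fin_cases j <;> simp [umat, Matrix.mul_apply, Fin.sum_univ_three] <;> ring

lemma umat_zero : umat 0 0 = 1 := by
  ext i j
  fin_cases i <;> fin_cases j <;> simp [umat]

lemma umat_inv (g : GL (Fin 3) ℂ) (a b : ℂ) (h : (g : Matrix (Fin 3) (Fin 3) ℂ) = umat a b) :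
    ((g⁻¹ : GL (Fin 3) ℂ) : Matrix (Fin 3) (Fin 3) ℂ) = umat (-a) (-b) := by
  have h1 : umat (-a) (-b) * (g : Matrix (Fin 3) (Fin 3) ℂ) = 1 := by
    rw [h, umat_mul]; simp [umat_zero]
  exact Units.inv_eq_of_mul_eq_one_left h1

lemma exists_umat (ρ : FreeGroup (Fin 2) →* GL (Fin 3) ℂ) (h : HasGivenValues ρ)
    (w : FreeGroup (Fin 2)) : ∃ a b : ℂ, (ρ w : Matrix (Fin 3) (Fin 3) ℂ) = umat a b := by
  induction w using FreeGroup.induction_on with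
  | C1 => exact ⟨0, 0, by simp [umat_zero]⟩
  | of i =>
    fin_cases i
    · exact ⟨1, 0, h.1⟩
    · exact ⟨0, 1, h.2⟩
  | inv_of i ih =>
    obtain ⟨a, b, hab⟩ := ih
    exact ⟨-a, -b, by rw [map_inv]; exact umat_inv _ _ _ hab⟩
  | mul x y hx hy =>
    obtain ⟨a, b, hab⟩ := hx
    obtain ⟨c, d, hcd⟩ := hy
    exact ⟨a + c, b + d, by rw [map_mul, Units.val_mul, hab, hcd, umat_mul]⟩

/-- The intertwiner. -/
def bmat (a b c d : ℂ) : Matrix (Fin 3) (Fin 3) ℂ := !![a, c, 0; b, d, 0; 0, 0, 1]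

lemma bmat_umat (a b c d p q r s : ℂ) (h : bmat a b c d * umat p q = umat r s * bmat a b c d) :
    a * p + c * q = r ∧ b * p + d * q = s := by
  have h0 := congrFun (congrFun h 0) 2
  have h1 := congrFun (congrFun h 1) 2
  simp [bmat, umat, Matrix.mul_apply, Fin.sum_univ_three] at h0 h1
  exact ⟨h0, h1⟩

lemma intertwine (ρ : FreeGroup (Fin 2) →* GL (Fin 3) ℂ) (h : HasGivenValues ρ)
    (φ : MulAut (FreeGroup (Fin 2))) (a b c d : ℂ)
    (hx : (ρ (φ (FreeGroup.of 0)) : Matrix (Fin 3) (Fin 3) ℂ) = umat a b)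
    (hy : (ρ (φ (FreeGroup.of 1)) : Matrix (Fin 3) (Fin 3) ℂ) = umat c d)
    (w : FreeGroup (Fin 2)) :
    bmat a b c d * (ρ w : Matrix (Fin 3) (Fin 3) ℂ) = (ρ (φ w)) * bmat a b c d := by
  induction w using FreeGroup.induction_on with
  | C1 => simp
  | of i =>
    fin_cases i
    · simp only [Fin.zero_eta, Fin.mk_one]
      rw [hx, h.1]
      ext i j
      fin_cases i <;> fin_cases j <;> simp [bmat, umat, Matrix.mul_apply, Fin.sum_univ_three]
    · simp only [Fin.zero_eta, Fin.mk_one]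
      rw [hy, h.2]
      ext i j
      fin_cases i <;> fin_cases j <;> simp [bmat, umat, Matrix.mul_apply, Fin.sum_univ_three]
  | inv_of i ih =>
    rw [map_inv, map_inv, map_inv]
    rw [Units.mul_inv_eq_iff_eq_mul, mul_assoc, ih, Units.inv_mul_cancel_left]
  | mul x y hx hy =>
    rw [map_mul, map_mul, map_mul, Units.val_mul, Units.val_mul, ← mul_assoc, hx, mul_assoc, hy,
      mul_assoc]

/-- There is a representation `ρ : F₂ → GL₃(ℂ)` with the given generator values; any
such `ρ` has infinite image, and its conjugacy class is fixed by every automorphism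
of `F₂`. -/
theorem free_group_rank_three_example :
    (∃ ρ : FreeGroup (Fin 2) →* GL (Fin 3) ℂ, HasGivenValues ρ) ∧
    ∀ ρ : FreeGroup (Fin 2) →* GL (Fin 3) ℂ, HasGivenValues ρ →
      Set.Infinite (Set.range ⇑ρ) ∧
      ∀ φ : MulAut (FreeGroup (Fin 2)), ∃ B : GL (Fin 3) ℂ,
        ∀ w : FreeGroup (Fin 2), ρ (φ w) = B * ρ w * B⁻¹ := by
  constructor
  · let u : ℂ → ℂ → GL (Fin 3) ℂ := fun a b =>
      ⟨umat a b, umat (-a) (-b), by rw [umat_mul]; simp [umat_zero],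
        by rw [umat_mul]; simp [umat_zero]⟩
    refine ⟨FreeGroup.lift ![u 1 0, u 0 1], ?_, ?_⟩ <;> simp [u, umat]
  intro ρ h
  constructor
  · have key : ∀ n : ℕ, (ρ (FreeGroup.of 0 ^ n) : Matrix (Fin 3) (Fin 3) ℂ) = umat n 0 := by
      intro n
      induction n with
      | zero => simp [umat_zero]
      | succ n ih =>
        have h0 : (ρ (FreeGroup.of 0) : Matrix (Fin 3) (Fin 3) ℂ) = umat 1 0 := h.1
        rw [pow_succ, map_mul, Units.val_mul, ih, h0, umat_mul]
        simp
    refine Set.infinite_of_injective_forall_mem (f := fun n : ℕ => ρ (FreeGroup.of 0 ^ n)) ?_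
      (fun n => ⟨_, rfl⟩)
    intro m n hmn
    have h1 : umat (m : ℂ) 0 = umat n 0 := by
      rw [← key, ← key]; exact congrArg Units.val hmn
    have h2 := congrFun (congrFun h1 0) 2
    simpa [umat] using h2
  · intro φ
    obtain ⟨a, b, hx⟩ := exists_umat ρ h (φ (FreeGroup.of 0))
    obtain ⟨c, d, hy⟩ := exists_umat ρ h (φ (FreeGroup.of 1))
    obtain ⟨p, q, hx'⟩ := exists_umat ρ h (φ⁻¹ (FreeGroup.of 0))
    obtain ⟨r, s, hy'⟩ := exists_umat ρ h (φ⁻¹ (FreeGroup.of 1))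
    have I := intertwine ρ h φ a b c d hx hy
    have h0 : (ρ (FreeGroup.of 0) : Matrix (Fin 3) (Fin 3) ℂ) = umat 1 0 := h.1
    have h1 : (ρ (FreeGroup.of 1) : Matrix (Fin 3) (Fin 3) ℂ) = umat 0 1 := h.2
    have e1 := I (φ⁻¹ (FreeGroup.of 0))
    have e2 := I (φ⁻¹ (FreeGroup.of 1))
    rw [MulAut.apply_inv_self, hx', h0] at e1
    rw [MulAut.apply_inv_self, hy', h1] at e2
    obtain ⟨e3, e4⟩ := bmat_umat _ _ _ _ _ _ _ _ e1
    obtain ⟨e5, e6⟩ := bmat_umat _ _ _ _ _ _ _ _ e2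
    have hB : bmat a b c d * bmat p q r s = 1 := by
      ext i j
      fin_cases i <;> fin_cases j <;>
        simp [bmat, Matrix.mul_apply, Fin.sum_univ_three, e3, e4, e5, e6]
    refine ⟨⟨bmat a b c d, bmat p q r s, hB, mul_eq_one_comm.mp hB⟩, fun w => ?_⟩
    rw [eq_mul_inv_iff_mul_eq]
    exact Units.ext (I w).symm
end
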